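/- arXiv:1803.04674 — 9 statements merged into one kernel-verified Lean document; each statement's English description precedes it below -/
import Mathlib

section
/- Let n ≥ 1 be a natural number, let γ be a real number with 0 < γ ≤ 1, and let d : Fin (n+1) → Fin (n+1) → ℝ be a nonnegative function (d i j ≥ 0 for all i, j), where index 0 is the starting point and indices 1,…,n are the reward points. For a bijection σ of {1,…,n} (a tour), define the cumulative distance D_σ(j) = d(0, σ(1)) + Σ_{t=1}^{j−1} d(σ(t), σ(t+1)) for 1 ≤ j ≤ n, and the discounted tour value V(σ) = Σ_{j=1}^{n} γ^{D_σ(j)} (real exponent). If τ is a tour whose first point is a nearest reward, i.e. d(0, τ(1)) ≤ d(0, i) for every i ∈ {1,…,n}, then for every tour σ one has V(σ) ≤ n · V(τ). -/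
/-- Cumulative distance traveled by the tour `σ` from the start (index `0`) until the
`j`-th collected reward: `D_σ(j) = d(0, σ(1)) + Σ_{t=1}^{j−1} d(σ(t), σ(t+1))`. -/
noncomputable def cumDist (n : ℕ) (d : Fin (n + 1) → Fin (n + 1) → ℝ)
    (σ : ℕ → Fin (n + 1)) (j : ℕ) : ℝ :=
  d 0 (σ 1) + ∑ t ∈ Finset.Ico 1 j, d (σ t) (σ (t + 1))

/-- Discounted tour value `V(σ) = Σ_{j=1}^{n} γ^{D_σ(j)}` (real exponent). -/
noncomputable def tourValue (n : ℕ) (γ : ℝ) (d : Fin (n + 1) → Fin (n + 1) → ℝ)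
    (σ : ℕ → Fin (n + 1)) : ℝ :=
  ∑ j ∈ Finset.Icc 1 n, γ ^ (cumDist n d σ j)

/-- A tour visits the reward points `1,…,n` (the nonzero indices of `Fin (n+1)`)
bijectively at times `1,…,n`. -/
def IsTour (n : ℕ) (σ : ℕ → Fin (n + 1)) : Prop :=
  Set.BijOn σ (Set.Icc 1 n) {i : Fin (n + 1) | i ≠ 0}

/-- **NN performance (Theorem 1).** If the tour `τ` first visits a nearest reward, then
any tour `σ` satisfies `V(σ) ≤ n · V(τ)`. -/
theorem nn_performance (n : ℕ) (hn : 1 ≤ n) (γ : ℝ) (hγ0 : 0 < γ) (hγ1 : γ ≤ 1)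
    (d : Fin (n + 1) → Fin (n + 1) → ℝ) (hd : ∀ i j, 0 ≤ d i j)
    (τ : ℕ → Fin (n + 1)) (hτ : IsTour n τ)
    (hnear : ∀ i : Fin (n + 1), i ≠ 0 → d 0 (τ 1) ≤ d 0 i)
    (σ : ℕ → Fin (n + 1)) (hσ : IsTour n σ) :
    tourValue n γ d σ ≤ n * tourValue n γ d τ := by
  have hσ1 : d 0 (τ 1) ≤ d 0 (σ 1) := hnear _ (hσ.mapsTo ⟨le_refl 1, hn⟩)
  have h1 : ∀ j ∈ Finset.Icc 1 n, γ ^ (cumDist n d σ j) ≤ γ ^ (d 0 (τ 1)) := by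
    intro j _
    apply Real.rpow_le_rpow_of_exponent_ge hγ0 hγ1
    have h := Finset.sum_nonneg (s := Finset.Ico 1 j)
      (fun t _ => hd (σ t) (σ (t + 1)))
    unfold cumDist
    linarith
  have h2 : γ ^ (d 0 (τ 1)) ≤ tourValue n γ d τ := by
    have h := Finset.single_le_sum (s := Finset.Icc 1 n)
      (f := fun j => γ ^ (cumDist n d τ j))
      (fun j _ => (Real.rpow_pos_of_pos hγ0 _).le) (Finset.mem_Icc.2 ⟨le_refl 1, hn⟩)
    simpa [cumDist, tourValue] using h
  calc tourValue n γ d σ ≤ ∑ _j ∈ Finset.Icc 1 n, γ ^ (d 0 (τ 1)) := Finset.sum_le_sum h1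
    _ = n * γ ^ (d 0 (τ 1)) := by simp
    _ ≤ n * tourValue n γ d τ := mul_le_mul_of_nonneg_left h2 (Nat.cast_nonneg n)
end

section
/- Let h ≥ 1 be a natural number and set n = 2h. Let γ = 1 − 1/n (a real number), and let d ≥ 0 be a real number with γ^d = 1/2 (real exponentiation). Then Σ_{i=1}^{h} γ^{(2i−1)d} + γ^{n·d+1} · Σ_{i=0}^{h−1} γ^i ≤ (24/n) · ( γ^d · Σ_{i=0}^{h−1} γ^i + γ^{2d + h − 1} · Σ_{i=1}^{h} γ^{(2i−1)d} ). -/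
/-- Core inequality in the impossibility result for deterministic local policies:
on the star graph with `n = 2h` leaves at distance `d` from the center (with
`γ^d = 1/2` and `γ = 1 − 1/n`), the return of a policy visiting the clique last
is at most `24/n` times the return of the tour collecting the clique first. -/
theorem det_local_impossibility_core (h : ℕ) (hh : 1 ≤ h) (n : ℕ) (hn : n = 2 * h)
    (γ : ℝ) (hγ : γ = 1 - 1 / (n : ℝ)) (d : ℝ) (hd : 0 ≤ d)
    (hγd : γ ^ d = 1 / 2) :
    ∑ i ∈ Finset.Icc 1 h, γ ^ ((2 * (i : ℝ) - 1) * d) +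
        γ ^ ((n : ℝ) * d + 1) * ∑ i ∈ Finset.range h, γ ^ ((i : ℝ)) ≤
      (24 / (n : ℝ)) *
        (γ ^ d * ∑ i ∈ Finset.range h, γ ^ ((i : ℝ)) +
          γ ^ (2 * d + (h : ℝ) - 1) *
            ∑ i ∈ Finset.Icc 1 h, γ ^ ((2 * (i : ℝ) - 1) * d)) := by
  have hh' : (1:ℝ) ≤ h := by exact_mod_cast hh
  have hnr : (n : ℝ) = 2 * h := by rw [hn]; push_cast; ring
  have hinv : 1 / (n : ℝ) ≤ 1 / 2 := by
    rw [hnr]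
    exact one_div_le_one_div_of_le (by norm_num) (by linarith)
  have hinv0 : 0 < 1 / (n : ℝ) := by rw [hnr]; positivity
  have hγ0 : 0 < γ := by linarith
  have hγ1 : γ ≤ 1 := by linarith
  have hpow : ∀ k : ℕ, γ ^ ((k : ℝ) * d) = (1 / 2 : ℝ) ^ k := by
    intro k
    rw [mul_comm, Real.rpow_mul hγ0.le, hγd, Real.rpow_natCast]
  -- the sum over the leaves
  have hS : ∀ m : ℕ, ∑ i ∈ Finset.Icc 1 m, γ ^ ((2 * (i : ℝ) - 1) * d)
      = 2 / 3 * (1 - (1 / 4 : ℝ) ^ m) := by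
    intro m
    induction m with
    | zero => simp
    | succ k ih =>
      rw [Finset.sum_Icc_succ_top (by omega), ih]
      have e : (2 * ((k + 1 : ℕ) : ℝ) - 1) * d = ((2 * k + 1 : ℕ) : ℝ) * d := by
        push_cast; ring
      rw [e, hpow, pow_succ, pow_mul, pow_succ]
      norm_num
      ring
  have h4pos : (0:ℝ) < (1 / 4 : ℝ) ^ h := by positivity
  have h4le : (1 / 4 : ℝ) ^ h ≤ 1 := pow_le_one₀ (by norm_num) (by norm_num)
  -- the clique sum
  have hGle : ∑ i ∈ Finset.range h, γ ^ ((i : ℝ)) ≤ h := by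
    calc _ ≤ ∑ i ∈ Finset.range h, (1:ℝ) := Finset.sum_le_sum fun i _ => by
          exact Real.rpow_le_one hγ0.le hγ1 (by positivity)
      _ = h := by simp
  have hGge : (h : ℝ) * (1 / 2) ≤ ∑ i ∈ Finset.range h, γ ^ ((i : ℝ)) := by
    calc (h : ℝ) * (1 / 2) = ∑ i ∈ Finset.range h, (1 / 2 : ℝ) := by simp
      _ ≤ _ := Finset.sum_le_sum fun i hi => by
          have hi' : (i : ℝ) ≤ h := by exact_mod_cast (Finset.mem_range.mp hi).le
          have hb := one_add_mul_le_pow (a := -(1 / (n : ℝ))) (by linarith) i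
          have hmul : (i : ℝ) * (1 / (n : ℝ)) ≤ 1 / 2 := by
            rw [hnr, mul_one_div, div_le_div_iff₀ (by positivity) (by norm_num)]
            linarith
          rw [Real.rpow_natCast, hγ, sub_eq_add_neg]
          linarith
  have hlast : γ ^ ((n : ℝ) * d + 1) ≤ (1 / 4 : ℝ) ^ h := by
    rw [Real.rpow_add hγ0, hpow, Real.rpow_one, hn, pow_mul]
    norm_num at h4pos ⊢
    nlinarith
  have h4h : (1 / 4 : ℝ) ^ h * h ≤ 1 := by
    have hb := one_add_mul_le_pow (a := (3 : ℝ)) (by norm_num) h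
    have e : (1 / 4 : ℝ) ^ h * (1 + 3) ^ h = 1 := by
      rw [← mul_pow]; norm_num
    exact (mul_le_mul_of_nonneg_left (by linarith) h4pos.le).trans_eq e
  rw [hS h, hγd]
  set G := ∑ i ∈ Finset.range h, γ ^ ((i : ℝ)) with hG
  have hG0 : 0 ≤ G := by linarith
  have hL : γ ^ ((n : ℝ) * d + 1) * G ≤ 1 :=
    le_trans (mul_le_mul hlast hGle hG0 h4pos.le) h4h
  have hR0 : 0 ≤ γ ^ (2 * d + (h : ℝ) - 1) * (2 / 3 * (1 - (1 / 4 : ℝ) ^ h)) :=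
    mul_nonneg (Real.rpow_nonneg hγ0.le _) (by linarith)
  have hR : (24 / (n : ℝ)) * (h * (1 / 4)) ≤ (24 / (n : ℝ)) *
      (1 / 2 * G + γ ^ (2 * d + (h : ℝ) - 1) * (2 / 3 * (1 - (1 / 4 : ℝ) ^ h))) :=
    mul_le_mul_of_nonneg_left (by linarith) (by positivity)
  have e3 : (24 / (n : ℝ)) * (h * (1 / 4)) = 3 := by
    rw [hnr]
    field_simp
    norm_num
  linarith
end

section
/- Let n ≥ 2 be a natural number, let k ≥ 1 be a natural number with (k : ℝ) ≤ logb 2 n, and let r : Fin k → ℕ satisfy r_i ≥ 1 for all i. If √n ≤ Σ_{i=1}^{k} 2^{r_i + 1} · i (as real numbers, with i ranging over 1,…,k), then Σ_{i=1}^{k} r_i ≥ (1/2)·logb 2 n − 2·logb 2 (logb 2 n) − 2. -/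
open Real in
/-- Quantitative core of Lemma 4 in the R-NN analysis: if
`√n ≤ Σ_{i=1}^{k} 2^{r_i+1}·i` with `k ≤ log₂ n` and `r_i ≥ 1`, then
`Σ_i r_i ≥ (1/2)·log₂ n − 2·log₂(log₂ n) − 2`. -/
theorem rnn_sum_rewards_lower_bound (n : ℕ) (hn : 2 ≤ n) (k : ℕ) (hk1 : 1 ≤ k)
    (hk : (k : ℝ) ≤ logb 2 n) (r : Fin k → ℕ) (hr : ∀ i, 1 ≤ r i)
    (hsum : Real.sqrt n ≤ ∑ i : Fin k, (2 : ℝ) ^ (r i + 1) * ((i : ℝ) + 1)) :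
    (1 / 2) * logb 2 n - 2 * logb 2 (logb 2 n) - 2 ≤ ∑ i : Fin k, (r i : ℝ) := by
  set S : ℕ := ∑ i : Fin k, r i with hS
  set L : ℝ := logb 2 n with hL
  have hkpos : (1 : ℝ) ≤ k := by exact_mod_cast hk1
  have hLpos : 0 < L := by linarith
  have hnpos : (0 : ℝ) < n := by
    have : 0 < n := by omega
    exact_mod_cast this
  have hterm : ∀ i ∈ (Finset.univ : Finset (Fin k)),
      (2 : ℝ) ^ (r i + 1) * ((i : ℝ) + 1) ≤ (2 : ℝ) ^ (S + 1) * L := by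
    intro i _
    have h1 : r i ≤ S := Finset.single_le_sum (f := r) (fun _ _ => Nat.zero_le _) (Finset.mem_univ i)
    have h2 : ((i : ℕ) : ℝ) + 1 ≤ k := by exact_mod_cast i.isLt
    have h3 : (2 : ℝ) ^ (r i + 1) ≤ 2 ^ (S + 1) :=
      pow_le_pow_right₀ (by norm_num) (by omega)
    exact mul_le_mul h3 (h2.trans hk) (by positivity) (by positivity)
  have hbound : Real.sqrt n ≤ (2 : ℝ) ^ (S + 1) * L ^ 2 := by
    have h := Finset.sum_le_sum hterm
    simp only [Finset.sum_const, Finset.card_univ, Fintype.card_fin, nsmul_eq_mul] at h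
    have h4 : (k : ℝ) * ((2 : ℝ) ^ (S + 1) * L) ≤ L * ((2 : ℝ) ^ (S + 1) * L) :=
      mul_le_mul_of_nonneg_right hk (by positivity)
    nlinarith
  have hlog : logb 2 (Real.sqrt n) ≤ logb 2 ((2 : ℝ) ^ (S + 1) * L ^ 2) :=
    Real.logb_le_logb_of_le (by norm_num) (Real.sqrt_pos.mpr hnpos) hbound
  rw [Real.sqrt_eq_rpow, Real.logb_rpow_eq_mul_logb_of_pos hnpos,
    Real.logb_mul (by positivity) (by positivity), Real.logb_pow, Real.logb_pow,
    Real.logb_self_eq_one (by norm_num)] at hlog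
  have hcast : ∑ i : Fin k, (r i : ℝ) = (S : ℝ) := by rw [hS]; push_cast; rfl
  rw [hcast]
  push_cast at hlog
  linarith
end

section
/- Let n ≥ 1 be a real number, let s be a natural number with (s : ℝ) ≤ √n, let c : Fin s → ℝ be nonnegative, and let α be a real number with 0 ≤ α ≤ 1 and Σ_j c_j = α·n. Then Σ_j c_j · min(c_j, √n) ≥ α² · n · √n / 4. -/
/-- Central combinatorial estimate for NN-RDFS (Step 1): if the nonnegative component
sizes `c_j` (at most `√n` of them) sum to `α·n`, then
`Σ_j c_j · min(c_j, √n) ≥ α²·n·√n/4`. -/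
theorem rdfs_component_estimate (n : ℝ) (hn : 1 ≤ n) (s : ℕ)
    (hs : (s : ℝ) ≤ Real.sqrt n) (c : Fin s → ℝ) (hc : ∀ j, 0 ≤ c j)
    (α : ℝ) (hα0 : 0 ≤ α) (hα1 : α ≤ 1) (hsum : ∑ j, c j = α * n) :
    α ^ 2 * n * Real.sqrt n / 4 ≤ ∑ j, c j * min (c j) (Real.sqrt n) := by
  obtain ⟨r, hr⟩ : ∃ r, r = Real.sqrt n := ⟨_, rfl⟩
  have hr0 : 0 ≤ r := hr ▸ Real.sqrt_nonneg n
  have hn2 : n = r ^ 2 := by rw [hr, Real.sq_sqrt (by linarith)]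
  rw [← hr] at hs ⊢
  have htr : α * r ≤ r := by nlinarith
  have key : ∀ j, α * r * c j - (α * r) ^ 2 / 4 ≤ c j * min (c j) r := by
    intro j
    rcases le_total (c j) r with h | h
    · rw [min_eq_left h]
      nlinarith [sq_nonneg (c j - α * r / 2)]
    · rw [min_eq_right h]
      nlinarith [mul_le_mul_of_nonneg_left htr (hc j), sq_nonneg (α * r)]
  have hsum2 := Finset.sum_le_sum (fun j (_ : j ∈ Finset.univ) => key j)
  rw [Finset.sum_sub_distrib, ← Finset.mul_sum, hsum, Finset.sum_const, Finset.card_univ,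
    Fintype.card_fin, nsmul_eq_mul] at hsum2
  refine le_trans ?_ hsum2
  have h1 := mul_le_mul_of_nonneg_right hs (sq_nonneg (α * r))
  have h2 : 0 ≤ r * (α * r) ^ 2 := by positivity
  rw [hn2]
  nlinarith
end

section
/- Let n ≥ 1 be a real number, let s be a natural number with (s : ℝ) ≤ n^{2/3}, let c : Fin s → ℝ be nonnegative, and let α be a real number with 0 ≤ α ≤ 1 and Σ_j c_j = α·n. Then Σ_j c_j · min(c_j, n^{1/3}) ≥ α² · n^{4/3} / 4. -/
/-- Central combinatorial estimate for NN-RA (Step 1): if the nonnegative component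
sizes `c_j` (at most `n^{2/3}` of them) sum to `α·n`, then
`Σ_j c_j · min(c_j, n^{1/3}) ≥ α²·n^{4/3}/4`. -/
theorem ra_component_estimate (n : ℝ) (hn : 1 ≤ n) (s : ℕ)
    (hs : (s : ℝ) ≤ n ^ ((2 : ℝ) / 3)) (c : Fin s → ℝ) (hc : ∀ j, 0 ≤ c j)
    (α : ℝ) (hα0 : 0 ≤ α) (hα1 : α ≤ 1) (hsum : ∑ j, c j = α * n) :
    α ^ 2 * n ^ ((4 : ℝ) / 3) / 4 ≤ ∑ j, c j * min (c j) (n ^ ((1 : ℝ) / 3)) := by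
  have hn0 : 0 ≤ n := by linarith
  obtain ⟨t, ht⟩ : ∃ t : ℝ, t = n ^ ((1 : ℝ) / 3) := ⟨_, rfl⟩
  have ht0 : 0 ≤ t := ht ▸ Real.rpow_nonneg hn0 _
  have h3 : n = t ^ 3 := by
    rw [ht, ← Real.rpow_natCast, ← Real.rpow_mul hn0]; norm_num
  have h2 : n ^ ((2 : ℝ) / 3) = t ^ 2 := by
    rw [ht, ← Real.rpow_natCast, ← Real.rpow_mul hn0]; norm_num
  have h4 : n ^ ((4 : ℝ) / 3) = t ^ 4 := by
    rw [ht, ← Real.rpow_natCast, ← Real.rpow_mul hn0]; norm_num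
  rw [h4, ← ht]
  rw [h2] at hs
  have key : ∀ j, α * t * c j - (α * t) ^ 2 / 4 ≤ c j * min (c j) t := by
    intro j
    rcases le_total (c j) t with h | h
    · rw [min_eq_left h]
      nlinarith [sq_nonneg (c j - α * t / 2)]
    · rw [min_eq_right h]
      nlinarith [mul_nonneg (mul_nonneg (hc j) ht0) (sub_nonneg.2 hα1), sq_nonneg (α * t)]
  have hsm := Finset.sum_le_sum (fun j (_ : j ∈ Finset.univ) => key j)
  rw [Finset.sum_sub_distrib, ← Finset.mul_sum, hsum, Finset.sum_const, Finset.card_univ,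
    Fintype.card_fin, nsmul_eq_mul, h3] at hsm
  have h5 := mul_le_mul_of_nonneg_right hs (sq_nonneg (α * t))
  have h6 : 0 ≤ α ^ 2 * t ^ 4 := by positivity
  nlinarith
end

section
/- For every real number n ≥ 4 and every real number t with 1 ≤ t ≤ n, one has 1/(2t) + (logb 2 t)/(2n) ≥ (logb 2 n)/(8n). -/
open Real in
/-- Optimization in Step 2 of the R-NN analysis: for `n ≥ 4` and `1 ≤ t ≤ n`,
`1/(2t) + log₂(t)/(2n) ≥ log₂(n)/(8n)`. -/
theorem rnn_tradeoff (n : ℝ) (hn : 4 ≤ n) (t : ℝ) (ht1 : 1 ≤ t) (htn : t ≤ n) :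
    logb 2 n / (8 * n) ≤ 1 / (2 * t) + logb 2 t / (2 * n) := by
  have ht : 0 < t := by linarith
  have hn0 : 0 < n := by linarith
  have hL : (1 / 2 : ℝ) < log 2 := by linarith [Real.log_two_gt_d9]
  have hx : 0 < n / t := div_pos hn0 ht
  have h1 : log (n / t) ≤ n / t - 1 := Real.log_le_sub_one_of_pos hx
  rw [Real.log_div hn0.ne' ht.ne'] at h1
  have h2 : 0 ≤ log t := Real.log_nonneg ht1
  have key : logb 2 n ≤ 4 * (n / t) + 4 * logb 2 t := by
    have e : 4 * (n / t) + 4 * logb 2 t = (4 * (n / t) * log 2 + 4 * log t) / log 2 := by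
      unfold Real.logb
      field_simp
    rw [e]
    unfold Real.logb
    apply div_le_div_of_nonneg_right _ (by linarith)
    nlinarith
  have e2 : 1 / (2 * t) + logb 2 t / (2 * n) = (4 * (n / t) + 4 * logb 2 t) / (8 * n) := by
    field_simp
    ring
  rw [e2]
  exact div_le_div_of_nonneg_right key (by positivity)
end

section
/- Let γ be a real number with 0 < γ < 1, let n ≥ 2 be a natural number, set x = logb (1/γ) 2 (so that γ^x = 1/2), and let K = ⌈logb 2 n⌉. Let D : Fin n → ℝ be nonnegative and set V = Σ_j γ^{D_j} (real exponents). Then there exists a natural number k < K such that Σ_{j : k·x ≤ D_j < (k+1)·x} γ^{D_j} ≥ (V − 1)/K. -/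
open Real in
/-- Step 3 of the NN-RDFS analysis: some length-`x` segment of the tour carries at
least a `1/K` fraction of the value `V − 1`, where `x = log_{1/γ} 2` is the
half-discount distance and `K = ⌈log₂ n⌉`. -/
theorem good_segment_exists (γ : ℝ) (hγ0 : 0 < γ) (hγ1 : γ < 1)
    (n : ℕ) (hn : 2 ≤ n) (x : ℝ) (hx : x = logb (1 / γ) 2)
    (K : ℕ) (hK : K = ⌈logb 2 n⌉₊) (D : Fin n → ℝ) (hD : ∀ j, 0 ≤ D j) :
    ∃ k : ℕ, k < K ∧
      ((∑ j : Fin n, γ ^ (D j)) - 1) / K ≤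
        ∑ j ∈ Finset.univ.filter
            (fun j : Fin n => (k : ℝ) * x ≤ D j ∧ D j < ((k : ℝ) + 1) * x),
          γ ^ (D j) := by
  have hxpos : 0 < x := by
    rw [hx]
    exact Real.logb_pos (by rw [lt_div_iff₀ hγ0]; linarith) (by norm_num)
  have hγx : γ ^ x = 1 / 2 := by
    have h1 : (1 / γ) ^ x = 2 := by
      rw [hx]
      apply Real.rpow_logb (by positivity) _ (by norm_num)
      intro h
      rw [div_eq_iff hγ0.ne'] at h
      linarith
    rw [Real.div_rpow (by norm_num) hγ0.le, Real.one_rpow] at h1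
    rw [← h1, one_div_one_div]
  have hnpos : (0 : ℝ) < n := by
    have : 0 < n := by omega
    exact_mod_cast this
  have hlog : 0 < logb 2 n := by
    apply Real.logb_pos (by norm_num)
    have : 1 < n := by omega
    exact_mod_cast this
  have hKpos : 0 < K := by
    rw [hK]
    exact Nat.ceil_pos.mpr hlog
  have hKR : (0 : ℝ) < K := by exact_mod_cast hKpos
  have hn2 : (n : ℝ) ≤ 2 ^ K := by
    have h1 : logb 2 n ≤ K := by
      rw [hK]
      exact Nat.le_ceil _
    rw [Real.logb_le_iff_le_rpow (by norm_num) hnpos] at h1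
    rwa [Real.rpow_natCast] at h1
  have hfar : ∀ d : ℝ, K * x ≤ d → γ ^ d ≤ 1 / n := by
    intro d hd
    calc γ ^ d ≤ γ ^ ((K : ℝ) * x) := Real.rpow_le_rpow_of_exponent_ge hγ0 hγ1.le hd
      _ = 1 / 2 ^ K := by
        rw [mul_comm, Real.rpow_mul hγ0.le, hγx, Real.rpow_natCast, div_pow, one_pow]
      _ ≤ 1 / n := one_div_le_one_div_of_le hnpos hn2
  have hpt : ∀ j : Fin n, γ ^ (D j) ≤ (∑ k ∈ Finset.range K,
      if (k : ℝ) * x ≤ D j ∧ D j < ((k : ℝ) + 1) * x then γ ^ (D j) else 0) + 1 / n := by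
    intro j
    have hnn : ∀ k ∈ Finset.range K, (0 : ℝ) ≤
        if (k : ℝ) * x ≤ D j ∧ D j < ((k : ℝ) + 1) * x then γ ^ (D j) else 0 := by
      intro k _
      split_ifs
      · positivity
      · exact le_rfl
    by_cases h : K * x ≤ D j
    · have := hfar _ h
      have := Finset.sum_nonneg hnn
      linarith
    · have hq : 0 ≤ D j / x := div_nonneg (hD j) hxpos.le
      have h1 : (⌊D j / x⌋₊ : ℝ) * x ≤ D j := by
        rw [← le_div_iff₀ hxpos]
        exact Nat.floor_le hq
      have h2 : D j < ((⌊D j / x⌋₊ : ℝ) + 1) * x := by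
        rw [← div_lt_iff₀ hxpos]
        exact Nat.lt_floor_add_one _
      have h3 : ⌊D j / x⌋₊ ∈ Finset.range K := by
        rw [Finset.mem_range, Nat.floor_lt hq, div_lt_iff₀ hxpos]
        exact not_le.mp h
      have h4 := Finset.single_le_sum hnn h3
      rw [if_pos ⟨h1, h2⟩] at h4
      have : (0 : ℝ) < 1 / n := by positivity
      linarith
  by_contra! hcon
  have hlt := Finset.sum_lt_sum_of_nonempty (s := Finset.range K)
    (Finset.nonempty_range_iff.mpr hKpos.ne') (fun k hk => hcon k (Finset.mem_range.mp hk))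
  have hsum := Finset.sum_le_sum (s := Finset.univ) (fun j _ => hpt j)
  rw [Finset.sum_add_distrib, Finset.sum_comm] at hsum
  simp only [← Finset.sum_filter] at hsum
  simp only [Finset.sum_const, Finset.card_range, Finset.card_univ, Fintype.card_fin,
    nsmul_eq_mul] at hsum hlt
  rw [mul_div_cancel₀ _ hKR.ne'] at hlt
  rw [mul_one_div_cancel hnpos.ne'] at hsum
  linarith
end

section
/- Let X be a pseudometric space, let C be a finite set of points of X, and let θ ≥ 0 be a real number. Suppose the proximity graph on C is connected, where the proximity graph has vertex set C and an edge between two distinct points a, b ∈ C whenever dist(a, b) ≤ θ. Then for every s ∈ C and every natural number j, the number of points c ∈ C with dist(s, c) ≤ j·θ is at least min(|C|, j + 1). -/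
/-- The proximity graph on a finite set `C` of points of a pseudometric space:
two distinct points are adjacent exactly when their distance is at most `θ`. -/
def proximityGraph {X : Type*} [PseudoMetricSpace X] (C : Finset X) (θ : ℝ) :
    SimpleGraph C :=
  SimpleGraph.fromRel fun a b => dist (a : X) (b : X) ≤ θ

/-- Ball-growth fact (underlying Lemma 3): if the proximity graph on `C` is
connected, then for every `s ∈ C` the ball of radius `j·θ` around `s` contains at
least `min(|C|, j+1)` points of `C`. -/
theorem ball_growth {X : Type*} [PseudoMetricSpace X] (C : Finset X) (θ : ℝ)
    (hθ : 0 ≤ θ) (hconn : (proximityGraph C θ).Connected)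
    (s : X) (hs : s ∈ C) (j : ℕ) :
    min C.card (j + 1) ≤ (C.filter fun c => dist s c ≤ (j : ℝ) * θ).card := by
  induction j with
  | zero =>
    refine le_trans (min_le_right _ _) ?_
    rw [zero_add, Nat.one_le_iff_ne_zero, Finset.card_ne_zero]
    exact ⟨s, by simp [hs]⟩
  | succ j ih =>
    have hmono : (C.filter fun c => dist s c ≤ (j : ℝ) * θ) ⊆
        (C.filter fun c => dist s c ≤ ((j + 1 : ℕ) : ℝ) * θ) := by
      intro c hc
      rw [Finset.mem_filter] at hc ⊢
      refine ⟨hc.1, ?_⟩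
      push_cast
      linarith [hc.2]
    by_cases hall : ∀ c ∈ C, dist s c ≤ (j : ℝ) * θ
    · have h := Finset.card_le_card hmono
      rw [Finset.filter_true_of_mem hall] at h
      exact le_trans (min_le_left _ _) h
    · push Not at hall
      obtain ⟨u, hu, hsu⟩ := hall
      obtain ⟨w⟩ := hconn.preconnected ⟨s, hs⟩ ⟨u, hu⟩
      obtain ⟨d, -, hd1, hd2⟩ := w.exists_boundary_dart
        {c | dist s (c : X) ≤ (j : ℝ) * θ}
        (by simp only [Set.mem_setOf_eq, dist_self]; positivity)
        (by simpa using hsu)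
      simp only [Set.mem_setOf_eq] at hd1 hd2
      have hadj : dist (d.fst : X) (d.snd : X) ≤ θ := by
        have h := d.adj
        simp only [proximityGraph, SimpleGraph.fromRel_adj] at h
        rcases h.2 with h | h
        · exact h
        · rwa [dist_comm]
      have hlt := Finset.card_lt_card (Finset.ssubset_iff_subset_ne.2 ⟨hmono, fun heq => hd2 (by
        have hmem : (d.snd : X) ∈ C.filter fun c => dist s c ≤ ((j + 1 : ℕ) : ℝ) * θ := by
          rw [Finset.mem_filter]
          refine ⟨d.snd.2, ?_⟩
          push_cast
          linarith [dist_triangle s (d.fst : X) (d.snd : X)]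
        rw [← heq, Finset.mem_filter] at hmem
        exact hmem.2)⟩)
      omega
end

section
/- Let X be a pseudometric space, let C be a finite set of points of X, and let θ ≥ 0 be a real number. Suppose the proximity graph on C is connected, where the proximity graph has vertex set C and an edge between two distinct points a, b ∈ C whenever dist(a, b) ≤ θ. Let k be a natural number, let s ∈ C, and let S ⊆ C be a subset with |S| ≤ k. If |C| ≥ k + 2, then there exists a point c ∈ C with c ∉ S, c ≠ s, and dist(s, c) ≤ (k + 1)·θ. -/
/-- **Lemma 3 (budget2).** If the proximity graph on `C` is connected, `s ∈ C`,
`S ⊆ C` has at most `k` elements and `|C| ≥ k + 2`, then there is an uncollected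
point `c ∈ C \ (S ∪ {s})` at distance at most `(k+1)·θ` from `s`. -/
theorem uncollected_reward_nearby {X : Type*} [PseudoMetricSpace X] (C : Finset X)
    (θ : ℝ) (hθ : 0 ≤ θ) (hconn : (proximityGraph C θ).Connected)
    (k : ℕ) (s : X) (hs : s ∈ C) (S : Finset X) (hS : S ⊆ C) (hScard : S.card ≤ k)
    (hC : k + 2 ≤ C.card) :
    ∃ c ∈ C, c ∉ S ∧ c ≠ s ∧ dist s c ≤ ((k : ℝ) + 1) * θ := by
  classical
  have key : ∀ j : ℕ, j ≤ k + 1 → ∃ T : Finset X, T ⊆ C ∧ s ∈ T ∧ T.card = j + 1 ∧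
      ∀ t ∈ T, dist s t ≤ (j : ℝ) * θ := by
    intro j
    induction j with
    | zero =>
      intro _
      exact ⟨{s}, by simpa using hs, by simp, by simp, by simp⟩
    | succ j ih =>
      intro hj
      obtain ⟨T, hTC, hsT, hTcard, hT⟩ := ih (by omega)
      obtain ⟨u, huC, huT⟩ : ∃ u ∈ C, u ∉ T :=
        Finset.exists_mem_notMem_of_card_lt_card (by omega)
      obtain ⟨p⟩ := hconn.preconnected ⟨s, hs⟩ ⟨u, huC⟩
      obtain ⟨d, -, hd1, hd2⟩ := p.exists_boundary_dart {x | (x : X) ∈ T} hsT huT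
      have hadj : dist (d.fst : X) (d.snd : X) ≤ θ := by
        have h := d.adj
        simp only [proximityGraph, SimpleGraph.fromRel_adj] at h
        rcases h.2 with h | h
        · exact h
        · rwa [dist_comm]
      have h1 : (d.fst : X) ∈ T := hd1
      have h2 : (d.snd : X) ∉ T := hd2
      refine ⟨insert (d.snd : X) T, Finset.insert_subset d.snd.2 hTC,
        Finset.mem_insert_of_mem hsT, by rw [Finset.card_insert_of_notMem h2, hTcard], ?_⟩
      intro t ht
      push_cast
      rcases Finset.mem_insert.1 ht with rfl | ht
      · linarith [hT _ h1, dist_triangle s (d.fst : X) (d.snd : X)]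
      · linarith [hT _ ht]
  obtain ⟨T, hTC, -, hTcard, hT⟩ := key (k + 1) le_rfl
  obtain ⟨c, hcT, hc⟩ : ∃ c ∈ T, c ∉ insert s S :=
    Finset.exists_mem_notMem_of_card_lt_card (by
      have := Finset.card_insert_le s S
      omega)
  rw [Finset.mem_insert, not_or] at hc
  exact ⟨c, hTC hcT, hc.2, hc.1, by simpa using hT c hcT⟩
end
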